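/- arXiv:0904.3586 — 2 statements merged into one kernel-verified Lean document; each statement's English description precedes it below -/
import Mathlib

section
/- Let k be a field of characteristic zero, N ≥ 1, and set n := N(N+1)/2, the dimension of the space of homogeneous quadrics in k[x_1, …, x_N]. Let F ∈ k[x_1, …, x_N] be a homogeneous quartic which is nondegenerate, meaning that the linear map sending a homogeneous quadric D to D(∂)F is a bijection from the space of homogeneous quadrics to itself. Let a_1, …, a_n ∈ k^N ∖ {0} be points such that the quadrics ℓ_{a_1}^2, …, ℓ_{a_n}^2 are linearly independent, and for each i let D_i be the unique homogeneous quadric with D_i(∂)F = ℓ_{a_i}^2. Then the following are equivalent: (i) there exist nonzero scalars α_1, …, α_n ∈ k with F = α_1 ℓ_{a_1}^4 + ⋯ + α_n ℓ_{a_n}^4; (ii) D_i(a_i) ≠ 0 for every i, and D_i(a_j) = 0 whenever i ≠ j. -/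
/-- The linear form `ℓ_a = a_1 x_1 + ⋯ + a_N x_N` associated to `a ∈ k^N`. -/
noncomputable def linForm {k : Type*} [CommSemiring k] {N : ℕ} (a : Fin N → k) :
    MvPolynomial (Fin N) k :=
  ∑ i, MvPolynomial.C (a i) * MvPolynomial.X i

/-- The differential operator `D(∂)` obtained from `D ∈ k[x_1, …, x_N]` by substituting
`∂/∂x_i` for `x_i`:  if `D = ∑_s c_s x^s` then `D(∂) = ∑_s c_s ∂^{s_1}/∂x_1^{s_1} ⋯`.  -/
noncomputable def diffOp {k : Type*} [CommSemiring k] {N : ℕ}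
    (D : MvPolynomial (Fin N) k) : Module.End k (MvPolynomial (Fin N) k) :=
  ∑ s ∈ D.support, MvPolynomial.coeff s D •
    (List.ofFn fun i : Fin N =>
      ((MvPolynomial.pderiv i).toLinearMap : Module.End k (MvPolynomial (Fin N) k)) ^ s i).prod

open MvPolynomial

section NoncommMonomial

variable {M : Type*} [Monoid M]

theorem List.prod_ofFn_pow_add {N : ℕ} (f : Fin N → M) (hf : ∀ i j, Commute (f i) (f j))
    (s t : Fin N → ℕ) :
    (List.ofFn fun i => f i ^ (s i + t i)).prod =
      (List.ofFn fun i => f i ^ s i).prod * (List.ofFn fun i => f i ^ t i).prod := by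
  induction N with
  | zero => simp
  | succ N ih =>
    have hcomm : Commute (f 0 ^ t 0) (List.ofFn fun i : Fin N => f i.succ ^ s i.succ).prod := by
      refine Commute.list_prod_right _ _ fun x hx => ?_
      obtain ⟨i, rfl⟩ := (List.mem_ofFn' _ _).1 hx
      exact (hf _ _).pow_pow _ _
    simp only [List.ofFn_succ, List.prod_cons]
    rw [ih (fun i => f i.succ) (fun i j => hf _ _) (fun i => s i.succ) fun i => t i.succ, pow_add,
      mul_assoc, mul_assoc, ← mul_assoc (f 0 ^ t 0), hcomm.eq, mul_assoc]

theorem List.prod_ofFn_pow_single {N : ℕ} (f : Fin N → M) (j : Fin N) :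
    (List.ofFn fun i => f i ^ (Finsupp.single j 1 : Fin N →₀ ℕ) i).prod = f j := by
  induction N with
  | zero => exact j.elim0
  | succ N ih =>
    rw [List.ofFn_succ, List.prod_cons]
    cases j using Fin.cases with
    | zero => simp
    | succ j =>
      have := ih (fun i => f i.succ) j
      simp_all [Finsupp.single_apply]

end NoncommMonomial

section DiffOp

variable {k : Type*} {N : ℕ}

theorem MvPolynomial.commute_pderiv [CommRing k] (i j : Fin N) :
    Commute ((pderiv i).toLinearMap : Module.End k (MvPolynomial (Fin N) k))
      (pderiv j).toLinearMap := by
  have h : ⁅(pderiv i : Derivation k (MvPolynomial (Fin N) k) (MvPolynomial (Fin N) k)),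
      (pderiv j : Derivation k (MvPolynomial (Fin N) k) (MvPolynomial (Fin N) k))⁆ = 0 := by
    refine derivation_ext fun l => ?_
    classical
    simp [Derivation.commutator_apply, pderiv_X, Pi.single_apply, apply_ite]
  refine LinearMap.ext fun p => sub_eq_zero.1 ?_
  simpa [Derivation.commutator_apply] using DFunLike.congr_fun h p

theorem diffOp_eq_sum [CommSemiring k] {D : MvPolynomial (Fin N) k}
    {S : Finset (Fin N →₀ ℕ)} (hS : D.support ⊆ S) :
    diffOp D = ∑ s ∈ S, coeff s D • (List.ofFn fun i : Fin N =>
      ((pderiv i).toLinearMap : Module.End k (MvPolynomial (Fin N) k)) ^ s i).prod := by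
  refine Finset.sum_subset hS fun s _ hs => ?_
  rw [notMem_support_iff.1 hs, zero_smul]

theorem diffOp_add [CommSemiring k] (D E : MvPolynomial (Fin N) k) :
    diffOp (D + E) = diffOp D + diffOp E := by
  classical
  rw [diffOp_eq_sum (support_add (p := D) (q := E)),
    diffOp_eq_sum (Finset.subset_union_left (s₁ := D.support) (s₂ := E.support)),
    diffOp_eq_sum (Finset.subset_union_right (s₁ := D.support) (s₂ := E.support)),
    ← Finset.sum_add_distrib]
  simp only [coeff_add, add_smul]

theorem diffOp_smul [CommSemiring k] (c : k) (D : MvPolynomial (Fin N) k) :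
    diffOp (c • D) = c • diffOp D := by
  rw [diffOp_eq_sum (support_smul (a := c) (f := D)), diffOp, Finset.smul_sum]
  simp only [coeff_smul, smul_eq_mul, mul_smul]

/-- The map `D ↦ D(∂)F` for a fixed polynomial `F`. -/
noncomputable def diffOpApply [CommSemiring k] (F : MvPolynomial (Fin N) k) :
    MvPolynomial (Fin N) k →ₗ[k] MvPolynomial (Fin N) k where
  toFun D := diffOp D F
  map_add' D E := by rw [diffOp_add, LinearMap.add_apply]
  map_smul' c D := by rw [diffOp_smul, LinearMap.smul_apply, RingHom.id_apply]

theorem diffOp_X_mul_X [CommRing k] (i j : Fin N) (F : MvPolynomial (Fin N) k) :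
    diffOp (X i * X j) F = pderiv i (pderiv j F) := by
  have hX : (X i * X j : MvPolynomial (Fin N) k) =
      monomial (Finsupp.single i 1 + Finsupp.single j 1) 1 := by
    simp [X, monomial_mul]
  rw [hX, diffOp_eq_sum support_monomial_subset, Finset.sum_singleton, coeff_monomial, if_pos rfl,
    one_smul]
  simp only [Finsupp.add_apply]
  rw [List.prod_ofFn_pow_add _ commute_pderiv, List.prod_ofFn_pow_single,
    List.prod_ofFn_pow_single]
  rfl

theorem pderiv_linForm [CommSemiring k] (a : Fin N → k) (i : Fin N) :
    pderiv i (linForm a) = C (a i) := by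
  classical
  simp [linForm, pderiv_X, Pi.single_apply]

end DiffOp

section Quadrics

variable {k : Type*} {N : ℕ}

theorem MvPolynomial.homogeneousSubmodule_two_eq_span [CommSemiring k] :
    homogeneousSubmodule (Fin N) k 2 =
      Submodule.span k (Set.range fun p : Fin N × Fin N => X p.1 * X p.2) := by
  rw [← homogeneousSubmodule_one_pow, pow_two, homogeneousSubmodule_one_eq_span_X,
    Submodule.span_mul_span, ← Set.image2_mul, Set.image2_range]

theorem diffOp_linForm_pow_four [CommRing k] (a : Fin N → k) {D : MvPolynomial (Fin N) k}
    (hD : D.IsHomogeneous 2) :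
    diffOp D (linForm a ^ 4) = (12 * eval a D) • linForm a ^ 2 := by
  rw [← mem_homogeneousSubmodule, homogeneousSubmodule_two_eq_span] at hD
  induction hD using Submodule.span_induction with
  | mem D h =>
    obtain ⟨⟨i, j⟩, rfl⟩ := h
    have hC (m : ℕ) : (m : MvPolynomial (Fin N) k) = C (m : k) := (map_natCast C m).symm
    have h12 : (C 12 : MvPolynomial (Fin N) k) = C 4 * C 3 := by rw [← C_mul]; norm_num
    simp only [diffOp_X_mul_X, pderiv_pow, pderiv_mul, pderiv_linForm, smul_eq_C_mul, hC, pderiv_C,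
      map_mul, eval_X, h12]
    simp
    ring
  | zero => simp [diffOp]
  | add D E _ _ hD hE => rw [diffOp_add, LinearMap.add_apply, hD, hE, map_add, mul_add, add_smul]
  | smul c D _ hD =>
    rw [diffOp_smul, LinearMap.smul_apply, hD, smul_eval, smul_smul]
    ring_nf

theorem diffOp_sum_smul_linForm_pow_four [CommRing k] {ι : Type*} [Fintype ι] (α : ι → k)
    (a : ι → Fin N → k) {D : MvPolynomial (Fin N) k} (hD : D.IsHomogeneous 2) :
    diffOp D (∑ i, α i • linForm (a i) ^ 4) =
      ∑ i, (12 * α i * eval (a i) D) • linForm (a i) ^ 2 := by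
  rw [map_sum]
  refine Finset.sum_congr rfl fun i _ => ?_
  rw [map_smul, diffOp_linForm_pow_four _ hD, smul_smul]
  ring_nf

theorem MvPolynomial.finrank_homogeneousSubmodule_two_le [Field k] :
    Module.finrank k (homogeneousSubmodule (Fin N) k 2) ≤ N * (N + 1) / 2 := by
  let f : Sym2 (Fin N) → MvPolynomial (Fin N) k :=
    Sym2.lift ⟨fun i j => X i * X j, fun i j => mul_comm _ _⟩
  have hf : (Set.range fun p : Fin N × Fin N => (X p.1 * X p.2 : MvPolynomial (Fin N) k)) =
      Set.range f := by
    ext p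
    simp [f, Sym2.exists]
  rw [homogeneousSubmodule_two_eq_span, hf]
  refine (finrank_range_le_card f).trans_eq ?_
  rw [Sym2.card, Fintype.card_fin, Nat.choose_two_right, Nat.add_sub_cancel, mul_comm]

theorem MvPolynomial.IsHomogeneous.eq_zero_of_pderiv_eq_zero [Field k] [CharZero k]
    {H : MvPolynomial (Fin N) k} {m : ℕ} (hH : H.IsHomogeneous m) (hm : m ≠ 0)
    (h : ∀ i, pderiv i H = 0) : H = 0 := by
  have := hH.sum_X_mul_pderiv
  simpa [h, hm] using this.symm

theorem MvPolynomial.IsHomogeneous.eq_zero_of_diffOp_eq_zero [Field k] [CharZero k]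
    {H : MvPolynomial (Fin N) k} (hH : H.IsHomogeneous 4)
    (h : ∀ D : MvPolynomial (Fin N) k, D.IsHomogeneous 2 → diffOp D H = 0) : H = 0 := by
  refine hH.eq_zero_of_pderiv_eq_zero (by simp) fun i =>
    hH.pderiv.eq_zero_of_pderiv_eq_zero (by simp) fun j => ?_
  rw [← diffOp_X_mul_X]
  exact h _ ((isHomogeneous_X k j).mul (isHomogeneous_X k i))

theorem linForm_isHomogeneous [CommSemiring k] (a : Fin N → k) : (linForm a).IsHomogeneous 1 :=
  IsHomogeneous.sum _ _ _ fun i _ => (isHomogeneous_X k i).C_mul _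

theorem span_eq_homogeneousSubmodule_two [Field k] {n : ℕ} (hn : n = N * (N + 1) / 2)
    {D : Fin n → MvPolynomial (Fin N) k} (hD2 : ∀ i, (D i).IsHomogeneous 2)
    (hD : LinearIndependent k D) :
    Submodule.span k (Set.range D) = homogeneousSubmodule (Fin N) k 2 := by
  have : Module.Finite k (homogeneousSubmodule (Fin N) k 2) :=
    Module.Finite.iff_fg.2 (homogeneousSubmodule_fg _ _ 2)
  refine Submodule.eq_of_le_of_finrank_le (Submodule.span_le.2 ?_) ?_
  · rintro _ ⟨i, rfl⟩
    exact hD2 i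
  · rw [finrank_span_eq_card hD, Fintype.card_fin, hn]
    exact finrank_homogeneousSubmodule_two_le

end Quadrics

/-- **Equivalence (5.4)⇔(5.6) in the proof of Theorem 5.4.1.**
Let `k` be a field of characteristic zero, `N ≥ 1`, and set `n := N(N+1)/2`, the dimension of
the space of homogeneous quadrics in `k[x_1, …, x_N]`.  Let `F` be a nondegenerate homogeneous
quartic, meaning that `D ↦ D(∂)F` is a bijection from the space of homogeneous quadrics to
itself.  Let `a_1, …, a_n ∈ k^N ∖ {0}` be points such that the quadrics `ℓ_{a_1}^2, …,
ℓ_{a_n}^2` are linearly independent, and for each `i` let `D_i` be the unique homogeneous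
quadric with `D_i(∂)F = ℓ_{a_i}^2`.  Then the following are equivalent:
(i) there exist nonzero scalars `α_1, …, α_n ∈ k` with `F = α_1 ℓ_{a_1}^4 + ⋯ + α_n ℓ_{a_n}^4`;
(ii) `D_i(a_i) ≠ 0` for every `i`, and `D_i(a_j) = 0` whenever `i ≠ j`. -/
theorem power_sum_iff_kronecker {k : Type*} [Field k] [CharZero k]
    (N : ℕ) (hN : 1 ≤ N) (n : ℕ) (hn : n = N * (N + 1) / 2)
    (F : MvPolynomial (Fin N) k) (hF : F.IsHomogeneous 4)
    (hFnd : ∀ E : MvPolynomial (Fin N) k, E.IsHomogeneous 2 →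
      ∃! D : MvPolynomial (Fin N) k, D.IsHomogeneous 2 ∧ diffOp D F = E)
    (a : Fin n → (Fin N → k)) (ha : ∀ i, a i ≠ 0)
    (hli : LinearIndependent k (fun i : Fin n => (linForm (a i)) ^ 2))
    (D : Fin n → MvPolynomial (Fin N) k)
    (hD2 : ∀ i, (D i).IsHomogeneous 2)
    (hDF : ∀ i, diffOp (D i) F = (linForm (a i)) ^ 2) :
    (∃ α : Fin n → k, (∀ i, α i ≠ 0) ∧
        F = ∑ i, α i • (linForm (a i)) ^ 4) ↔
      ((∀ i, MvPolynomial.eval (a i) (D i) ≠ 0) ∧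
        (∀ i j, i ≠ j → MvPolynomial.eval (a j) (D i) = 0)) := by
  constructor
  · rintro ⟨α, -, hα⟩
    have key : ∀ i j, 12 * α j * eval (a j) (D i) = if i = j then 1 else 0 := by
      intro i
      have h := hDF i
      rw [hα, diffOp_sum_smul_linForm_pow_four α a (hD2 i)] at h
      refine fun j => congr_fun (sub_eq_zero.1 (_root_.funext fun j => Fintype.linearIndependent_iff.1 hli
        ((fun j => 12 * α j * eval (a j) (D i)) - fun j => if i = j then 1 else 0) ?_ j)) j
      simp [sub_smul, h]
    refine ⟨fun i h => ?_, fun i j hij => ?_⟩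
    · simpa [h] using key i i
    · have hj : 12 * α j ≠ 0 := left_ne_zero_of_mul_eq_one ((key j j).trans (if_pos rfl))
      simpa [hij, hj] using key i j
  · rintro ⟨hdiag, hoff⟩
    refine ⟨fun i => (12 * eval (a i) (D i))⁻¹,
      fun i => inv_ne_zero (mul_ne_zero (by norm_num) (hdiag i)), ?_⟩
    have hDli : LinearIndependent k D := by
      refine LinearIndependent.of_comp (diffOpApply F) ?_
      rwa [show diffOpApply F ∘ D = fun i => linForm (a i) ^ 2 from _root_.funext hDF]
    have hspan := span_eq_homogeneousSubmodule_two hn hD2 hDli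
    rw [← sub_eq_zero]
    refine IsHomogeneous.eq_zero_of_diffOp_eq_zero (hF.sub (IsHomogeneous.sum _ _ _ fun i _ => ?_))
      fun E hE => ?_
    · rw [smul_eq_C_mul]
      exact ((linForm_isHomogeneous (a i)).pow 4).C_mul _
    · rw [← mem_homogeneousSubmodule, ← hspan] at hE
      refine Submodule.span_le (p := LinearMap.ker (diffOpApply _)).2 ?_ hE
      rintro _ ⟨i, rfl⟩
      change diffOp (D i) (F - _) = 0
      rw [map_sub, hDF, diffOp_sum_smul_linForm_pow_four _ a (hD2 i), Finset.sum_eq_single i]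
      · rw [mul_right_comm, mul_inv_cancel₀ (mul_ne_zero (by norm_num) (hdiag i)), one_smul,
          sub_self]
      · intro j _ hj
        rw [hoff i j hj.symm, mul_zero, zero_smul]
      · simp
end

section
/- Let k be a field of characteristic zero, N ≥ 1, and set n := N(N+1)/2, the dimension of the space of homogeneous quadrics in k[x_1, …, x_N]. Let D_1, …, D_n ∈ k[x_1, …, x_N] be homogeneous quadrics and a_1, …, a_n ∈ k^N points such that D_i(a_i) ≠ 0 for all i and D_i(a_j) = 0 whenever i ≠ j. Then D_1, …, D_n form a basis of the space of homogeneous quadrics, and every homogeneous quartic G ∈ k[x_1, …, x_N] with G(a_i) = 0 for all i = 1, …, n lies in the k-linear span of the products D_i D_j with 1 ≤ i < j ≤ n. -/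
open MvPolynomial in
theorem MvPolynomial.finrank_homogeneousSubmodule_two (k : Type*) [Field k] (N : ℕ) :
    Module.finrank k (homogeneousSubmodule (Fin N) k 2) = N * (N + 1) / 2 := by
  have e : homogeneousSubmodule (Fin N) k 2 =
      restrictSupport k (Finset.univ.finsuppAntidiag 2 : Finset (Fin N →₀ ℕ)) := by
    rw [homogeneousSubmodule_eq_finsupp_supported]
    congr 1
    ext d
    simp [Finsupp.degree_eq_sum]
  rw [e, Module.finrank_eq_nat_card_basis (basisRestrictSupport k _)]
  simp only [Nat.card_eq_fintype_card, Fintype.card_coe, SetLike.coe_sort_coe,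
    Finset.card_finsuppAntidiag_nat_eq_choose, Finset.card_univ, Fintype.card_fin]
  cases N with
  | zero => rfl
  | succ m =>
    rw [show m + 1 + 2 - 1 = m + 2 by lia, Nat.choose_two_right]
    congr 1
    exact Nat.mul_comm _ _

/-- **Quadrics with a Kronecker-type vanishing condition form a basis, and quartics through
the points lie in the span of their pairwise products (key step in Theorem 5.4.1).**
Let `k` be a field of characteristic zero, `N ≥ 1`, and set `n := N(N+1)/2`, the dimension of
the space of homogeneous quadrics in `k[x_1, …, x_N]`.  Let `D_1, …, D_n` be homogeneous
quadrics and `a_1, …, a_n ∈ k^N` points such that `D_i(a_i) ≠ 0` for all `i` and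
`D_i(a_j) = 0` whenever `i ≠ j`.  Then `D_1, …, D_n` form a basis of the space of homogeneous
quadrics, and every homogeneous quartic `G` with `G(a_i) = 0` for all `i` lies in the
`k`-linear span of the products `D_i D_j` with `1 ≤ i < j ≤ n`. -/
theorem quadrics_basis_and_quartics_in_span_of_products {k : Type*} [Field k] [CharZero k]
    (N : ℕ) (hN : 1 ≤ N) (n : ℕ) (hn : n = N * (N + 1) / 2)
    (D : Fin n → MvPolynomial (Fin N) k) (hD2 : ∀ i, (D i).IsHomogeneous 2)
    (a : Fin n → (Fin N → k))
    (hdiag : ∀ i, MvPolynomial.eval (a i) (D i) ≠ 0)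
    (hoff : ∀ i j, i ≠ j → MvPolynomial.eval (a j) (D i) = 0) :
    (LinearIndependent k D ∧
      Submodule.span k (Set.range D) = MvPolynomial.homogeneousSubmodule (Fin N) k 2) ∧
    (∀ G : MvPolynomial (Fin N) k, G.IsHomogeneous 4 →
      (∀ i, MvPolynomial.eval (a i) G = 0) →
      G ∈ Submodule.span k
        {P : MvPolynomial (Fin N) k | ∃ i j : Fin n, i < j ∧ P = D i * D j}) := by
  have hindep : LinearIndependent k D := by
    rw [Fintype.linearIndependent_iff]
    intro c hc j
    have h := congrArg (MvPolynomial.eval (a j)) hc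
    rw [map_sum, Finset.sum_eq_single j] at h
    · simpa [MvPolynomial.smul_eval, hdiag j] using h
    · intro i _ hij
      simp [MvPolynomial.smul_eval, hoff i j hij]
    · simp
  have hfin := MvPolynomial.finrank_homogeneousSubmodule_two k N
  have hspan : Submodule.span k (Set.range D) = MvPolynomial.homogeneousSubmodule (Fin N) k 2 := by
    have : Module.Finite k (MvPolynomial.homogeneousSubmodule (Fin N) k 2) :=
      Module.Finite.iff_fg.mpr (MvPolynomial.homogeneousSubmodule_fg _ _ 2)
    refine Submodule.eq_of_le_of_finrank_eq ?_ ?_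
    · rw [Submodule.span_le]
      rintro _ ⟨i, rfl⟩
      exact hD2 i
    · rw [finrank_span_eq_card hindep, hfin, Fintype.card_fin, hn]
  refine ⟨⟨hindep, hspan⟩, fun G hG hGa => ?_⟩
  set S : Set (MvPolynomial (Fin N) k) := {P | ∃ i j : Fin n, i < j ∧ P = D i * D j}
  have hle : MvPolynomial.homogeneousSubmodule (Fin N) k 4 ≤
      Submodule.span k (Set.range fun i => D i * D i) ⊔ Submodule.span k S := by
    rw [← MvPolynomial.homogeneousSubmodule_one_pow _ 4, show 4 = 2 + 2 from rfl, pow_add,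
      MvPolynomial.homogeneousSubmodule_one_pow _ 2, ← hspan, Submodule.span_mul_span,
      Submodule.span_le]
    rintro _ ⟨_, ⟨i, rfl⟩, _, ⟨j, rfl⟩, rfl⟩
    rcases lt_trichotomy i j with h | rfl | h
    · exact Submodule.mem_sup_right (Submodule.subset_span ⟨i, j, h, rfl⟩)
    · exact Submodule.mem_sup_left (Submodule.subset_span ⟨i, rfl⟩)
    · exact Submodule.mem_sup_right (Submodule.subset_span ⟨j, i, h, mul_comm _ _⟩)
  have hvanish : ∀ j, ∀ s ∈ Submodule.span k S, MvPolynomial.eval (a j) s = 0 := by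
    intro j s hs
    induction hs using Submodule.span_induction with
    | mem x hx =>
      obtain ⟨p, q, hpq, rfl⟩ := hx
      rcases eq_or_ne p j with rfl | hp
      · simp [hoff q p hpq.ne']
      · simp [hoff p j hp]
    | zero => simp
    | add x y _ _ hx hy => simp [hx, hy]
    | smul c x _ hx => simp [MvPolynomial.smul_eval, hx]
  obtain ⟨q, hq, s, hs, rfl⟩ := Submodule.mem_sup.mp (hle hG)
  obtain ⟨c, rfl⟩ := (Submodule.mem_span_range_iff_exists_fun k).mp hq
  have hc : ∀ j, c j = 0 := by
    intro j
    have h := hGa j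
    rw [map_add, hvanish j s hs, add_zero, map_sum, Finset.sum_eq_single j] at h
    · simpa [MvPolynomial.smul_eval, hdiag j] using h
    · intro i _ hij
      simp [MvPolynomial.smul_eval, hoff i j hij]
    · simp
  simpa [hc] using hs
end
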